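/- arXiv:2006.00893 — 4 statements merged into one kernel-verified Lean document; each statement's English description precedes it below -/
import Mathlib

section
/- Let 𝓑 be an unbounded bornology on an infinite set κ such that the family {κ \ B : B ∈ 𝓑} is not an ultrafilter on κ (i.e., there exists S ⊆ κ with S ∉ 𝓑 and κ \ S ∉ 𝓑). Then the hyperballean [κ]^𝓑 is normal if and only if 𝓑 has a linearly ordered base. -/
/-- A bornology on a set (type) `κ`: a family of subsets containing all finite
subsets, closed under taking subsets and finite unions. -/
def IsBornology {κ : Type*} (𝓑 : Set (Set κ)) : Prop :=
  (∀ A : Set κ, A.Finite → A ∈ 𝓑) ∧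
  (∀ A B : Set κ, A ∈ 𝓑 → B ⊆ A → B ∈ 𝓑) ∧
  (∀ A B : Set κ, A ∈ 𝓑 → B ∈ 𝓑 → A ∪ B ∈ 𝓑)

/-- Ball `E_B[Y]` in the discrete ballean determined by a bornology:
`E_B[Y] = Y ∪ B` if `Y ∩ B ≠ ∅`, and `E_B[Y] = Y` otherwise. -/
def dE {κ : Type*} (B Y : Set κ) : Set κ :=
  Y ∪ {x | x ∈ B ∧ (Y ∩ B).Nonempty}

/-- `A` and `A'` are `B`-close in the hyperballean sense. -/
def hClose {κ : Type*} (B A A' : Set κ) : Prop :=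
  A ⊆ dE B A' ∧ A' ⊆ dE B A

/-- The carrier of the hyperballean `[κ]^𝓑`: all nonempty members of `𝓑`. -/
def hyper {κ : Type*} (𝓑 : Set (Set κ)) : Set (Set κ) :=
  {A | A ∈ 𝓑 ∧ A.Nonempty}

/-- `E_B♭[𝒜]`: the points of `[κ]^𝓑` that are `B`-close to a member of `𝒜`. -/
def hE {κ : Type*} (𝓑 : Set (Set κ)) (B : Set κ) (𝒜 : Set (Set κ)) : Set (Set κ) :=
  {A | A ∈ hyper 𝓑 ∧ ∃ A' ∈ 𝒜, hClose B A A'}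

/-- A subset of `[κ]^𝓑` is bounded if all its members are `B`-close to a single
point, for some `B ∈ 𝓑`. -/
def hBounded {κ : Type*} (𝓑 : Set (Set κ)) (𝒜 : Set (Set κ)) : Prop :=
  ∃ B ∈ 𝓑, ∃ A₀ ∈ hyper 𝓑, ∀ A ∈ 𝒜, hClose B A A₀

/-- Asymptotic disjointness in `[κ]^𝓑`. -/
def hAsympDisjoint {κ : Type*} (𝓑 : Set (Set κ)) (𝒜₁ 𝒜₂ : Set (Set κ)) : Prop :=
  ∀ B ∈ 𝓑, hBounded 𝓑 (hE 𝓑 B 𝒜₁ ∩ hE 𝓑 B 𝒜₂)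

/-- `U` is an asymptotic neighbourhood of `𝒜` in `[κ]^𝓑`. -/
def hAsympNbhd {κ : Type*} (𝓑 : Set (Set κ)) (𝒜 U : Set (Set κ)) : Prop :=
  ∀ B ∈ 𝓑, hBounded 𝓑 (hE 𝓑 B 𝒜 \ U)

/-- The hyperballean `[κ]^𝓑` is normal. -/
def hNormal {κ : Type*} (𝓑 : Set (Set κ)) : Prop :=
  ∀ 𝒜₁ 𝒜₂ : Set (Set κ), 𝒜₁ ⊆ hyper 𝓑 → 𝒜₂ ⊆ hyper 𝓑 → hAsympDisjoint 𝓑 𝒜₁ 𝒜₂ →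
    ∃ U V : Set (Set κ), hAsympNbhd 𝓑 𝒜₁ U ∧ hAsympNbhd 𝓑 𝒜₂ V ∧ Disjoint U V

/-- `𝓑` has a linearly ordered base. -/
def HasLinearBase {κ : Type*} (𝓑 : Set (Set κ)) : Prop :=
  ∃ 𝓒 ⊆ 𝓑, IsChain (· ⊆ ·) 𝓒 ∧ ∀ B ∈ 𝓑, ∃ C ∈ 𝓒, B ⊆ C

open Set Cardinal

universe u

section Hyperballean

variable {κ : Type*} {𝓑 : Set (Set κ)}

theorem dE_subset_union (B Y : Set κ) : dE B Y ⊆ Y ∪ B :=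
  union_subset_union_right Y fun _ hx => hx.1

theorem dE_mono {B C : Set κ} (h : B ⊆ C) (Y : Set κ) : dE B Y ⊆ dE C Y :=
  union_subset_union_right Y fun _ hx => ⟨h hx.1, hx.2.mono (inter_subset_inter_right Y h)⟩

theorem hE_mono {B C : Set κ} (h : B ⊆ C) (𝒜 : Set (Set κ)) : hE 𝓑 B 𝒜 ⊆ hE 𝓑 C 𝒜 := by
  rintro A ⟨hA, A', hA', h₁, h₂⟩
  exact ⟨hA, A', hA', h₁.trans (dE_mono h A'), h₂.trans (dE_mono h A)⟩

/-- A set of points is bounded in the hyperballean iff its union lies in the bornology. -/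
theorem hBounded_iff [Nonempty κ] (hB : IsBornology 𝓑) {𝒜 : Set (Set κ)} (h𝒜 : 𝒜 ⊆ hyper 𝓑) :
    hBounded 𝓑 𝒜 ↔ ∃ C ∈ 𝓑, ∀ A ∈ 𝒜, A ⊆ C := by
  constructor
  · rintro ⟨B, hBB, A₀, hA₀, h⟩
    exact ⟨A₀ ∪ B, hB.2.2 _ _ hA₀.1 hBB, fun A hA => (h A hA).1.trans (dE_subset_union B A₀)⟩
  · rintro ⟨C, hC, h⟩
    obtain ⟨x⟩ := ‹Nonempty κ›
    have hx : C ∪ {x} ∈ 𝓑 := hB.2.2 _ _ hC (hB.1 _ (finite_singleton x))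
    refine ⟨C ∪ {x}, hx, C ∪ {x}, ⟨hx, x, Or.inr rfl⟩, fun A hA => ?_⟩
    have hAC : A ⊆ C ∪ {x} := (h A hA).trans subset_union_left
    obtain ⟨a, ha⟩ := (h𝒜 hA).2
    exact ⟨hAC.trans subset_union_left, fun y hy => Or.inr ⟨hy, a, ha, hAC ha⟩⟩

theorem hNormal_of_hasLinearBase [Nonempty κ] (hB : IsBornology 𝓑) (h : HasLinearBase 𝓑) :
    hNormal 𝓑 := by
  obtain ⟨𝓒, h𝓒, hchain, hcof⟩ := h
  intro 𝒜₁ 𝒜₂ _ _ hdisj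
  have hD : ∀ C : Set κ, ∃ D : Set κ, C ∈ 𝓑 → D ∈ 𝓑 ∧ ∀ A ∈ hE 𝓑 C 𝒜₁ ∩ hE 𝓑 C 𝒜₂, A ⊆ D := by
    intro C
    by_cases hC : C ∈ 𝓑
    · obtain ⟨D, hD, h⟩ := (hBounded_iff hB fun A hA => hA.1.1).1 (hdisj C hC)
      exact ⟨D, fun _ => ⟨hD, h⟩⟩
    · exact ⟨∅, fun h => absurd h hC⟩
  choose D hD using hD
  have hnbhd : ∀ 𝒜 : Set (Set κ), hAsympNbhd 𝓑 𝒜 {A | ∃ C ∈ 𝓒, A ∈ hE 𝓑 C 𝒜 ∧ ¬ A ⊆ D C} := by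
    intro 𝒜 B hBB
    obtain ⟨C, hC, hBC⟩ := hcof B hBB
    refine (hBounded_iff hB fun A hA => hA.1.1).2 ⟨D C, (hD C (h𝓒 hC)).1, fun A hA => ?_⟩
    by_contra hAD
    exact hA.2 ⟨C, hC, hE_mono hBC 𝒜 hA.1, hAD⟩
  refine ⟨_, _, hnbhd 𝒜₁, hnbhd 𝒜₂, disjoint_left.2 ?_⟩
  rintro A ⟨C, hC, hA, hAC⟩ ⟨C', hC', hA', hAC'⟩
  rcases hchain.total hC hC' with h | h
  · exact hAC' ((hD C' (h𝓒 hC')).2 A ⟨hE_mono h 𝒜₁ hA, hA'⟩)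
  · exact hAC ((hD C (h𝓒 hC)).2 A ⟨hA, hE_mono h 𝒜₂ hA'⟩)

theorem hAsympDisjoint_subsets_compl [Nonempty κ] (hB : IsBornology 𝓑) (S : Set κ) :
    hAsympDisjoint 𝓑 {A | A ∈ hyper 𝓑 ∧ A ⊆ S} {A | A ∈ hyper 𝓑 ∧ A ⊆ Sᶜ} := by
  intro B hBB
  refine (hBounded_iff hB fun A hA => hA.1.1).2 ⟨B, hBB, ?_⟩
  rintro A ⟨⟨-, A₁, ⟨-, hA₁⟩, h₁, -⟩, -, A₂, ⟨-, hA₂⟩, h₂, -⟩ x hx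
  rcases dE_subset_union B A₁ (h₁ hx) with hx₁ | hx₁
  · rcases dE_subset_union B A₂ (h₂ hx) with hx₂ | hx₂
    · exact absurd (hA₁ hx₁) (hA₂ hx₂)
    · exact hx₂
  · exact hx₁

/-- Members `P ∪ Q` of the hyperballean are close to subsets of `S` when the part `Q` is small. -/
theorem union_mem_hE (hB : IsBornology 𝓑) {S P Q B : Set κ} {s : κ} (hP : P ∈ 𝓑) (hQ : Q ∈ 𝓑)
    (hPS : P ⊆ S) (hs : s ∈ P) (hsB : s ∈ B) (hQB : Q ⊆ B) :
    P ∪ Q ∈ hE 𝓑 B {A | A ∈ hyper 𝓑 ∧ A ⊆ S} :=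
  ⟨⟨hB.2.2 _ _ hP hQ, s, Or.inl hs⟩, P, ⟨⟨hP, s, hs⟩, hPS⟩,
    union_subset_union_right P fun _ hx => ⟨hQB hx, s, hs, hsB⟩,
    subset_union_left.trans subset_union_left⟩

theorem hAsympNbhd.exists_superset [Nonempty κ] (hB : IsBornology 𝓑) {𝒜 U : Set (Set κ)}
    (hU : hAsympNbhd 𝓑 𝒜 U) {B₀ : Set κ} (hB₀ : B₀ ∈ 𝓑) (B : Set κ) :
    ∃ F ∈ 𝓑, B ∈ 𝓑 → ∀ A ∈ hE 𝓑 (B ∪ B₀) 𝒜, A ∉ U → A ⊆ F := by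
  by_cases h : B ∈ 𝓑
  · obtain ⟨F, hF, hA⟩ := (hBounded_iff hB fun A hA => hA.1.1).1 (hU _ (hB.2.2 _ _ h hB₀))
    exact ⟨F, hF, fun _ A hA₁ hA₂ => hA A ⟨hA₁, hA₂⟩⟩
  · exact ⟨∅, hB.1 _ finite_empty, fun h' => absurd h' h⟩

theorem hNormal.exists_dominating [Nonempty κ] (hB : IsBornology 𝓑) (hN : hNormal 𝓑) {S : Set κ}
    (hS : S.Nonempty) (hSc : Sᶜ.Nonempty) :
    ∃ f : Set κ → Set κ, (∀ P, f P ∈ 𝓑) ∧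
      ∀ P ∈ 𝓑, ∀ Q ∈ 𝓑, P ∩ S ⊆ f Q ∨ Q ∩ Sᶜ ⊆ f P := by
  obtain ⟨s, hs⟩ := hS
  obtain ⟨t, ht⟩ := hSc
  obtain ⟨U, V, hU, hV, hUV⟩ := hN _ _ (fun _ h => h.1) (fun _ h => h.1)
    (hAsympDisjoint_subsets_compl hB S)
  have hs𝓑 : {s} ∈ 𝓑 := hB.1 _ (finite_singleton s)
  have ht𝓑 : {t} ∈ 𝓑 := hB.1 _ (finite_singleton t)
  have hst : {s} ∪ {t} ∈ 𝓑 := hB.2.2 _ _ hs𝓑 ht𝓑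
  choose F hF hFU using fun B => hU.exists_superset hB hst B
  choose G hG hGV using fun B => hV.exists_superset hB hst B
  refine ⟨fun B => F B ∪ G B, fun B => hB.2.2 _ _ (hF B) (hG B), fun P hP Q hQ => ?_⟩
  have hP' : P ∩ S ∪ {s} ∈ 𝓑 := hB.2.2 _ _ (hB.2.1 _ _ hP inter_subset_left) hs𝓑
  have hQ' : Q ∩ Sᶜ ∪ {t} ∈ 𝓑 := hB.2.2 _ _ (hB.2.1 _ _ hQ inter_subset_left) ht𝓑
  by_cases hA : (P ∩ S ∪ {s}) ∪ (Q ∩ Sᶜ ∪ {t}) ∈ U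
  · right
    have h := hGV P hP ((Q ∩ Sᶜ ∪ {t}) ∪ (P ∩ S ∪ {s}))
      (union_mem_hE hB hQ' hP' (union_subset inter_subset_right (singleton_subset_iff.2 ht))
        (Or.inr rfl) (Or.inr (Or.inr rfl))
        (union_subset_union inter_subset_left subset_union_left))
      (by rw [union_comm]; exact disjoint_left.1 hUV hA)
    exact fun x hx => Or.inr (h (Or.inl (Or.inl hx)))
  · left
    have h := hFU Q hQ _
      (union_mem_hE hB hP' hQ' (union_subset inter_subset_right (singleton_subset_iff.2 hs))
        (Or.inr rfl) (Or.inr (Or.inl rfl))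
        (union_subset_union inter_subset_left subset_union_right)) hA
    exact fun x hx => Or.inl (h (Or.inl (Or.inl hx)))

/-- A family whose traces on `S` are not contained in a common member of `𝓑`. -/
def TraceUnbounded (𝓑 : Set (Set κ)) (S : Set κ) (𝒳 : Set (Set κ)) : Prop :=
  ∀ B ∈ 𝓑, ∃ P ∈ 𝒳, ¬ P ∩ S ⊆ B

theorem traceUnbounded_of_cofinal (hB : IsBornology 𝓑) {S : Set κ} (hS : S ∉ 𝓑)
    {𝒳 : Set (Set κ)} (h : ∀ Q ∈ 𝓑, ∃ P ∈ 𝒳, Q ∩ S ⊆ P) : TraceUnbounded 𝓑 S 𝒳 := by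
  intro B hBB
  by_contra! hcon
  refine hS (hB.2.1 _ _ hBB fun x hx => ?_)
  obtain ⟨P, hP, hxP⟩ := h {x} (hB.1 _ (finite_singleton x))
  exact hcon P hP ⟨hxP ⟨rfl, hx⟩, hx⟩

theorem TraceUnbounded.cofinal_image {S T : Set κ} {𝒳 : Set (Set κ)} {f : Set κ → Set κ}
    (h𝒳 : 𝒳 ⊆ 𝓑) (hf : ∀ P, f P ∈ 𝓑)
    (hdom : ∀ P ∈ 𝓑, ∀ Q ∈ 𝓑, P ∩ S ⊆ f Q ∨ Q ∩ T ⊆ f P) (h : TraceUnbounded 𝓑 S 𝒳) :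
    ∀ Q ∈ 𝓑, ∃ P ∈ f '' 𝒳, Q ∩ T ⊆ P := by
  intro Q hQ
  obtain ⟨P, hP, hPQ⟩ := h (f Q) (hf Q)
  exact ⟨f P, mem_image_of_mem f hP, (hdom P (h𝒳 hP) Q hQ).resolve_left hPQ⟩

/-- If every family of fewer than `#ι` members of `𝓑` is bounded, then any family indexed by `ι`
is dominated by a chain indexed by `ι`. -/
theorem exists_chain_dominating {ι κ : Type u} {𝓑 : Set (Set κ)} (hB : IsBornology 𝓑)
    (hadd : ∀ 𝒴 ⊆ 𝓑, #𝒴 < #ι → ∃ B ∈ 𝓑, ∀ Y ∈ 𝒴, Y ⊆ B)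
    (g : ι → Set κ) (hg : ∀ i, g i ∈ 𝓑) :
    ∃ C : ι → Set κ, (∀ i, C i ∈ 𝓑) ∧ (∀ i, g i ⊆ C i) ∧ ∀ i j, C i ⊆ C j ∨ C j ⊆ C i := by
  obtain ⟨_, _, hord⟩ := Cardinal.exists_ord_eq_type_lt ι
  have hbd : ∀ 𝒴 : Set (Set κ), ∃ B ∈ 𝓑, 𝒴 ⊆ 𝓑 → #𝒴 < #ι → ∀ Y ∈ 𝒴, Y ⊆ B := by
    intro 𝒴
    by_cases h : 𝒴 ⊆ 𝓑 ∧ #𝒴 < #ι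
    · obtain ⟨B, hBB, hY⟩ := hadd 𝒴 h.1 h.2
      exact ⟨B, hBB, fun _ _ => hY⟩
    · exact ⟨∅, hB.1 _ finite_empty, fun h₁ h₂ => absurd ⟨h₁, h₂⟩ h⟩
  choose bd hbd𝓑 hbd using hbd
  have hwf : WellFounded ((· < ·) : ι → ι → Prop) := wellFounded_lt
  let C : ι → Set κ := hwf.fix fun i ih => g i ∪ bd (range fun j : Iio i => ih j.1 j.2)
  have hC : ∀ i, C i = g i ∪ bd (range fun j : Iio i => C j.1) := fun i => hwf.fix_eq _ i
  have hC𝓑 : ∀ i, C i ∈ 𝓑 := fun i => by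
    rw [hC]
    exact hB.2.2 _ _ (hg i) (hbd𝓑 _)
  have hmono : Monotone C := by
    refine monotone_iff_forall_lt.2 fun j i hji => ?_
    have h := hbd _ (range_subset_iff.2 fun j : Iio i => hC𝓑 j.1)
      (mk_range_le.trans_lt (Cardinal.mk_Iio_lt i hord)) (C j) ⟨⟨j, hji⟩, rfl⟩
    rw [hC i]
    exact h.trans subset_union_right
  refine ⟨C, hC𝓑, fun i => by rw [hC]; exact subset_union_left, fun i j => ?_⟩
  exact (le_total i j).imp (fun h => hmono h) fun h => hmono h

theorem hasLinearBase_of_dominating (hB : IsBornology 𝓑) {S : Set κ} (hS : S ∉ 𝓑)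
    (hSc : Sᶜ ∉ 𝓑) {f : Set κ → Set κ} (hf : ∀ P, f P ∈ 𝓑)
    (hdom : ∀ P ∈ 𝓑, ∀ Q ∈ 𝓑, P ∩ S ⊆ f Q ∨ Q ∩ Sᶜ ⊆ f P) : HasLinearBase 𝓑 := by
  have hf_image : ∀ 𝒳, f '' 𝒳 ⊆ 𝓑 := fun 𝒳 => image_subset_iff.2 fun P _ => hf P
  have hdom' : ∀ Q ∈ 𝓑, ∀ P ∈ 𝓑, Q ∩ Sᶜ ⊆ f P ∨ P ∩ S ⊆ f Q :=
    fun Q hQ P hP => (hdom P hP Q hQ).symm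
  obtain ⟨𝒳, ⟨h𝒳, hunb⟩, hmin⟩ := (InvImage.wf (fun 𝒳 : Set (Set κ) => #𝒳) Cardinal.lt_wf).has_min
    {𝒳 | 𝒳 ⊆ 𝓑 ∧ TraceUnbounded 𝓑 S 𝒳}
    ⟨𝓑, subset_rfl, traceUnbounded_of_cofinal hB hS fun Q hQ => ⟨Q, hQ, inter_subset_left⟩⟩
  have hadd : ∀ 𝒴 ⊆ 𝓑, #𝒴 < #𝒳 → ∃ B ∈ 𝓑, ∀ Y ∈ 𝒴, Y ⊆ B := by
    intro 𝒴 h𝒴 hlt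
    have h₁ : ¬ TraceUnbounded 𝓑 S 𝒴 := fun h => hmin 𝒴 ⟨h𝒴, h⟩ hlt
    have h₂ : ¬ TraceUnbounded 𝓑 Sᶜ 𝒴 := fun h => hmin (f '' 𝒴)
      ⟨hf_image 𝒴, traceUnbounded_of_cofinal hB hS (h.cofinal_image h𝒴 hf hdom')⟩
      (mk_image_le.trans_lt hlt)
    unfold TraceUnbounded at h₁ h₂
    push Not at h₁ h₂
    obtain ⟨B₁, hB₁, h₁⟩ := h₁
    obtain ⟨B₂, hB₂, h₂⟩ := h₂
    refine ⟨B₁ ∪ B₂, hB.2.2 _ _ hB₁ hB₂, fun Y hY => ?_⟩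
    rw [← inter_union_compl Y S]
    exact union_subset_union (h₁ Y hY) (h₂ Y hY)
  have hcofT := hunb.cofinal_image h𝒳 hf hdom
  have hcofS := (traceUnbounded_of_cofinal hB hSc hcofT).cofinal_image (hf_image 𝒳) hf hdom'
  obtain ⟨C, hC, hle, htot⟩ := exists_chain_dominating hB hadd
    (fun p : 𝒳 => f p ∪ f (f p)) fun p => hB.2.2 _ _ (hf _) (hf _)
  refine ⟨range C, range_subset_iff.2 hC, ?_, fun B hBB => ?_⟩
  · rintro _ ⟨p, rfl⟩ _ ⟨q, rfl⟩ -
    exact htot p q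
  · obtain ⟨_, ⟨p, hp, rfl⟩, hBp⟩ := hcofT B hBB
    obtain ⟨_, ⟨_, ⟨q, hq, rfl⟩, rfl⟩, hBq⟩ := hcofS B hBB
    have hp' : B ∩ Sᶜ ⊆ C ⟨p, hp⟩ := hBp.trans (subset_union_left.trans (hle ⟨p, hp⟩))
    have hq' : B ∩ S ⊆ C ⟨q, hq⟩ := hBq.trans (subset_union_right.trans (hle ⟨q, hq⟩))
    rw [← inter_union_compl B S]
    rcases htot ⟨p, hp⟩ ⟨q, hq⟩ with h | h
    · exact ⟨_, mem_range_self _, union_subset hq' (hp'.trans h)⟩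
    · exact ⟨_, mem_range_self _, union_subset (hq'.trans h) hp'⟩

end Hyperballean

/-- **Proposition 2.3.** If `{κ \ B : B ∈ 𝓑}` is not an ultrafilter, then the
hyperballean `[κ]^𝓑` is normal iff `𝓑` has a linearly ordered base. -/
theorem hyperballean_normal_iff_hasLinearBase {κ : Type*} [Infinite κ]
    (𝓑 : Set (Set κ)) (hB : IsBornology 𝓑) (hunb : Set.univ ∉ 𝓑)
    (hnotultra : ∃ S : Set κ, S ∉ 𝓑 ∧ Sᶜ ∉ 𝓑) :
    hNormal 𝓑 ↔ HasLinearBase 𝓑 := by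
  refine ⟨fun hN => ?_, hNormal_of_hasLinearBase hB⟩
  obtain ⟨S, hS, hSc⟩ := hnotultra
  have hne : ∀ T : Set κ, T ∉ 𝓑 → T.Nonempty := fun T hT =>
    nonempty_iff_ne_empty.2 fun h => hT (h ▸ hB.1 ∅ finite_empty)
  obtain ⟨f, hf, hdom⟩ := hNormal.exists_dominating hB hN (hne S hS) (hne Sᶜ hSc)
  exact hasLinearBase_of_dominating hB hS hSc hf hdom
end

section
/- Let 𝓑 be an unbounded bornology on an infinite set κ such that the family {κ \ B : B ∈ 𝓑} is an ultrafilter on κ. Then the hyperballean [κ]^𝓑 is not normal. -/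
/-- A bounded family in the hyperballean has its union contained in a member of the bornology. -/
theorem hBounded.exists_subset {κ : Type*} {𝓑 : Set (Set κ)} (hB : IsBornology 𝓑)
    {𝒜 : Set (Set κ)} (h : hBounded 𝓑 𝒜) : ∃ D ∈ 𝓑, ∀ A ∈ 𝒜, A ⊆ D := by
  obtain ⟨B, hBB, A₀, hA₀, h⟩ := h
  refine ⟨A₀ ∪ B, hB.2.2 _ _ hA₀.1 hBB, fun A hA x hx => ?_⟩
  exact ((h A hA).1 hx).imp_right And.left

/-- A family of nonempty subsets of a member of the bornology is bounded in the hyperballean. -/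
theorem hBounded_of_subset {κ : Type*} {𝓑 : Set (Set κ)} {𝒜 : Set (Set κ)} {D : Set κ}
    (hD : D ∈ hyper 𝓑) (h : ∀ A ∈ 𝒜, A.Nonempty ∧ A ⊆ D) : hBounded 𝓑 𝒜 := by
  refine ⟨D, hD.1, D, hD, fun A hA => ⟨fun x hx => Or.inl ((h A hA).2 hx), fun x hx => ?_⟩⟩
  obtain ⟨⟨a, ha⟩, hAD⟩ := h A hA
  exact Or.inr ⟨hx, a, ha, hAD ha⟩

/-- A well-ordered set without maximum splits into two cofinal parts. -/
theorem exists_cofinal_compl_cofinal {R : Type*} [LinearOrder R] [WellFoundedLT R]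
    [NoMaxOrder R] : ∃ P : R → Prop, ∀ a, (∃ b, a ≤ b ∧ P b) ∧ ∃ b, a ≤ b ∧ ¬ P b := by
  let P : R → Prop := WellFounded.fix (wellFounded_lt (α := R))
    fun i p => ∃ j, ∃ h : j < i, j ⋖ i ∧ ¬ p j h
  have hP (i : R) : P i ↔ ∃ j, ∃ _ : j < i, j ⋖ i ∧ ¬ P j :=
    iff_of_eq (WellFounded.fix_eq _ _ i)
  have hcov {i j : R} (h : j ⋖ i) : P i ↔ ¬ P j := by
    rw [hP]
    refine ⟨?_, fun hj => ⟨j, h.lt, h, hj⟩⟩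
    rintro ⟨k, -, hk, hPk⟩
    rwa [h.unique_left hk]
  refine ⟨P, fun a => ?_⟩
  let := SuccOrder.ofLinearWellFoundedLT R
  have ha := Order.covBy_succ a
  by_cases h : P a
  · exact ⟨⟨a, le_rfl, h⟩, _, ha.le, fun h' => (hcov ha).1 h' h⟩
  · exact ⟨⟨_, ha.le, (hcov ha).2 h⟩, a, le_rfl, h⟩

/-- A bornology consisting of the sets on which a map into a well-ordered set is bounded
does not come from an ultrafilter. -/
theorem not_ultra_of_rank {κ ι : Type*} [LinearOrder ι] [WellFoundedLT ι] {𝓑 : Set (Set κ)}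
    (hunb : Set.univ ∉ 𝓑) (ρ : κ → ι) (hρ : ∀ S, S ∈ 𝓑 ↔ ∃ a, ∀ x ∈ S, ρ x ≤ a) :
    ∃ S : Set κ, S ∉ 𝓑 ∧ Sᶜ ∉ 𝓑 := by
  have hlt (a : ι) : ∃ x, a < ρ x := by
    by_contra! h
    exact hunb ((hρ _).2 ⟨a, fun x _ => h x⟩)
  have : NoMaxOrder (Set.range ρ) :=
    ⟨fun a => (hlt a).elim fun x hx => ⟨⟨ρ x, x, rfl⟩, hx⟩⟩
  obtain ⟨P, hP⟩ := exists_cofinal_compl_cofinal (R := Set.range ρ)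
  refine ⟨{x | P ⟨ρ x, x, rfl⟩}, fun h => ?_, fun h => ?_⟩ <;>
  · obtain ⟨a, ha⟩ := (hρ _).1 h
    obtain ⟨x, hx⟩ := hlt a
    obtain ⟨⟨⟨_, y, rfl⟩, hy, hPy⟩, ⟨_, z, rfl⟩, hz, hPz⟩ := hP ⟨ρ x, x, rfl⟩
    first
    | exact (hx.trans_le hy).not_ge (ha y hPy)
    | exact (hx.trans_le hz).not_ge (ha z hPz)

/-- The points of a well-ordered set whose initial segments lie in an unbounded bornology
form a set outside the bornology. -/
theorem setOf_Iio_mem_notMem {κ : Type*} [LinearOrder κ] [WellFoundedLT κ] {𝓑 : Set (Set κ)}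
    (hB : IsBornology 𝓑) (hunb : Set.univ ∉ 𝓑) : {x : κ | Set.Iio x ∈ 𝓑} ∉ 𝓑 := by
  intro hI
  obtain ⟨m, hm, hmin⟩ := WellFounded.has_min (wellFounded_lt (α := κ))
    {x : κ | Set.Iio x ∈ 𝓑}ᶜ (Set.nonempty_compl.2 fun h => hunb (h ▸ hI))
  exact hm (hB.2.1 _ _ hI fun x hx => by_contra fun h => hmin x h hx)

/-- If the hyperballean is normal, then the bornology has a base that is, in a strong sense,
indexed by a well-ordered set. -/
theorem hNormal.exists_tail_base {κ : Type*} [Nonempty κ] [LinearOrder κ] [WellFoundedLT κ]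
    {𝓑 : Set (Set κ)} (hB : IsBornology 𝓑) (hunb : Set.univ ∉ 𝓑) (hN : hNormal 𝓑) :
    ∃ φ : {x : κ // Set.Iio x ∈ 𝓑} → Set κ, (∀ i, φ i ∈ 𝓑) ∧
      ∀ T ∈ 𝓑, ∃ a, ∀ i, a ≤ i → T ⊆ φ i := by
  obtain ⟨o⟩ := ‹Nonempty κ›
  have hI := setOf_Iio_mem_notMem hB hunb
  have hins {D : Set κ} (x : κ) (hD : D ∈ 𝓑) : insert x D ∈ 𝓑 := by
    rw [Set.insert_eq]
    exact hB.2.2 _ _ (hB.1 _ (Set.finite_singleton x)) hD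
  have hpick {D : Set κ} (hD : D ∈ 𝓑) : ∃ a : {x : κ // Set.Iio x ∈ 𝓑}, a.1 ∉ D := by
    by_contra! h
    exact hI (hB.2.1 _ _ hD fun x hx => h ⟨x, hx⟩)
  let F (i : {x : κ // Set.Iio x ∈ 𝓑}) : Set κ := insert o (Set.Iic i.1)
  have hF (i) : F i ∈ 𝓑 := by
    apply hins
    rw [← Set.Iio_insert]
    exact hins _ i.2
  have hoF (i) : o ∈ F i := Set.mem_insert _ _
  have hdisj : hAsympDisjoint 𝓑 (Set.range fun x => ({o, x} : Set κ)) (Set.range F) := by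
    intro B hBB
    obtain ⟨b, hb⟩ := hpick (hins o hBB)
    obtain ⟨c, hc⟩ := hpick (hins b.1 (hins o hBB))
    refine hBounded_of_subset (D := F (max b c) ∪ B)
      ⟨hB.2.2 _ _ (hF _) hBB, o, Or.inl (hoF _)⟩ ?_
    rintro A ⟨⟨hA, _, ⟨x, rfl⟩, h₁⟩, -, _, ⟨i, rfl⟩, h₂⟩
    refine ⟨hA.2, fun y hy => ?_⟩
    have hFx : ∀ z ∈ F i, z = o ∨ z = x ∨ z ∈ B := by
      intro z hz
      rcases h₂.2 hz with h | h
      · rcases h₁.1 h with h | h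
        · exact h.imp_right Or.inl
        · exact Or.inr (Or.inr h.1)
      · exact Or.inr (Or.inr h.1)
    have hi : i ≤ max b c := by
      by_contra! h
      have hb' := hFx b (Or.inr ((le_max_left b c).trans h.le))
      have hc' := hFx c (Or.inr ((le_max_right b c).trans h.le))
      simp only [Set.mem_insert_iff, not_or] at hb hc
      grind
    rcases h₂.1 hy with (h | h) | h
    · exact Or.inl (Or.inl h)
    · exact Or.inl (Or.inr (le_trans (show y ≤ i.1 from h) hi))
    · exact Or.inr h.1
  obtain ⟨U, V, hU, hV, hUV⟩ := hN _ _
    (by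
      rintro _ ⟨x, rfl⟩
      exact ⟨hB.1 _ (Set.toFinite _), o, Or.inl rfl⟩)
    (by
      rintro _ ⟨i, rfl⟩
      exact ⟨hF i, o, hoF i⟩) hdisj
  choose f hf hfU using fun i => (hU (F i) (hF i)).exists_subset hB
  refine ⟨f, hf, fun T hT => ?_⟩
  obtain ⟨G, hG, hGV⟩ := (hV (insert o T) (hins o hT)).exists_subset hB
  obtain ⟨a, ha⟩ := hpick hG
  refine ⟨a, fun i hai x hx => ?_⟩
  have hA : insert x (F i) ∈ hyper 𝓑 := ⟨hins x (hF i), x, Or.inl rfl⟩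
  have hA₁ : insert x (F i) ∈ hE 𝓑 (F i) (Set.range fun x => ({o, x} : Set κ)) := by
    refine ⟨hA, _, ⟨x, rfl⟩, ?_, ?_⟩
    · rintro y (rfl | hy)
      · exact Or.inl (Or.inr rfl)
      · exact Or.inr ⟨hy, o, Or.inl rfl, hoF i⟩
    · rintro y (rfl | rfl)
      · exact Or.inl (Or.inr (hoF i))
      · exact Or.inl (Or.inl rfl)
  have hA₂ : insert x (F i) ∈ hE 𝓑 (insert o T) (Set.range F) := by
    refine ⟨hA, _, ⟨i, rfl⟩, ?_, fun y hy => Or.inl (Or.inr hy)⟩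
    rintro y (rfl | hy)
    · exact Or.inr ⟨Or.inr hx, o, hoF i, Or.inl rfl⟩
    · exact Or.inl hy
  have hAV : insert x (F i) ∈ V := by
    by_contra h
    exact ha (hGV _ ⟨hA₂, h⟩ (Or.inr (Or.inr hai)))
  exact hfU i _ ⟨hA₁, fun h => Set.disjoint_left.1 hUV h hAV⟩ (Or.inl rfl)

/-- **Corollary 4.2.** If `{κ \ B : B ∈ 𝓑}` is an ultrafilter on `κ`, then the
hyperballean `[κ]^𝓑` is not normal. -/
theorem hyperballean_not_normal_of_ultrafilter {κ : Type*} [Infinite κ]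
    (𝓑 : Set (Set κ)) (hB : IsBornology 𝓑) (hunb : Set.univ ∉ 𝓑)
    (hultra : ∀ S : Set κ, S ∈ 𝓑 ∨ Sᶜ ∈ 𝓑) :
    ¬ hNormal 𝓑 := by
  intro hN
  obtain ⟨_, _⟩ := exists_wellFoundedLT κ
  obtain ⟨φ, hφ, hT⟩ := hN.exists_tail_base hB hunb
  have hρ (x : κ) : ∃ a, (∀ i, a ≤ i → x ∈ φ i) ∧ ∀ b, (∀ i, b ≤ i → x ∈ φ i) → a ≤ b := by
    obtain ⟨a, ha⟩ := hT {x} (hB.1 _ (Set.finite_singleton x))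
    obtain ⟨m, hm, hmin⟩ := WellFounded.has_min
      (wellFounded_lt (α := {x : κ // Set.Iio x ∈ 𝓑})) {a | ∀ i, a ≤ i → x ∈ φ i}
      ⟨a, fun i hi => ha i hi rfl⟩
    exact ⟨m, hm, fun b hb => not_lt.1 (hmin b hb)⟩
  choose ρ hρmem hρmin using hρ
  obtain ⟨S, hS, hS'⟩ := not_ultra_of_rank hunb ρ fun S =>
    ⟨fun hS => (hT S hS).imp fun a ha x hx => hρmin x a fun i hi => ha i hi hx,
      fun ⟨a, ha⟩ => hB.2.1 _ _ (hφ a) fun x hx => hρmem x a (ha x hx)⟩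
  exact (hultra S).elim hS hS'
end

section
/- Let 𝓑 be an unbounded bornology on an infinite set κ and fix a point p ∈ κ. Then: (1) the identity map from the hyperballean [κ]^𝓑 to the 𝓑-macrocube (sending a nonempty set A ∈ 𝓑 to itself, i.e., to its characteristic function) is macrouniform: for every B ∈ 𝓑 there exists B' ∈ 𝓑 such that whenever A, A' ∈ [κ]^𝓑 are B-close in the hyperballean sense, then A Δ A' ⊆ B'; and (2) its restriction to K_p = {A ∈ [κ]^𝓑 : p ∈ A} is an asymorphism onto its image: in addition, for every B ∈ 𝓑 there exists B' ∈ 𝓑 such that whenever A, A' ∈ K_p and A Δ A' ⊆ B, then A and A' are B'-close in the hyperballean sense. -/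
open scoped symmDiff

/-- **Proposition 2.1.** The identity map from the hyperballean `[κ]^𝓑` to the
`𝓑`-macrocube is macrouniform, and its restriction to
`K_p = {A ∈ [κ]^𝓑 : p ∈ A}` is an asymorphism onto its image. -/
theorem hyperballean_to_macrocube_macrouniform_and_asymorphism_on_Kp
    {κ : Type*} [Infinite κ] (𝓑 : Set (Set κ)) (hB : IsBornology 𝓑)
    (hunb : Set.univ ∉ 𝓑) (p : κ) :
    (∀ B ∈ 𝓑, ∃ B' ∈ 𝓑, ∀ A ∈ hyper 𝓑, ∀ A' ∈ hyper 𝓑,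
        hClose B A A' → A ∆ A' ⊆ B') ∧
    (∀ B ∈ 𝓑, ∃ B' ∈ 𝓑, ∀ A ∈ {A ∈ hyper 𝓑 | p ∈ A}, ∀ A' ∈ {A ∈ hyper 𝓑 | p ∈ A},
        A ∆ A' ⊆ B → hClose B' A A') := by
  refine ⟨fun B hBB ↦ ⟨B, hBB, ?_⟩, fun B hBB ↦ ⟨B ∪ {p}, ?_, ?_⟩⟩
  · rintro A - A' - ⟨h, h'⟩ x (⟨hx, hx'⟩ | ⟨hx, hx'⟩)
    · exact ((h hx).resolve_left hx').1
    · exact ((h' hx).resolve_left hx').1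
  · exact hB.2.2 _ _ hBB (hB.1 _ (Set.finite_singleton p))
  · rintro A ⟨-, hp⟩ A' ⟨-, hp'⟩ h
    refine ⟨fun x hx ↦ ?_, fun x hx ↦ ?_⟩
    · by_cases hx' : x ∈ A'
      · exact Or.inl hx'
      · exact Or.inr ⟨Or.inl (h (Or.inl ⟨hx, hx'⟩)), p, hp', Or.inr rfl⟩
    · by_cases hx' : x ∈ A
      · exact Or.inl hx'
      · exact Or.inr ⟨Or.inl (h (Or.inr ⟨hx, hx'⟩)), p, hp, Or.inr rfl⟩
end

section
/- Let 𝓑 be an unbounded bornology on an infinite set κ. In the hyperballean [κ]^𝓑, the set of singletons [κ]^𝓑_1 = {A ∈ [κ]^𝓑 : |A| = 1} and its complement [κ]^𝓑 \ [κ]^𝓑_1 are asymptotically disjoint. -/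
theorem dE_eq_self {κ : Type*} {B Y : Set κ} (h : ¬ (Y ∩ B).Nonempty) : dE B Y = Y := by
  simp [dE, h]

/-- A set close to a singleton, and not equal to that singleton, lies inside `B`. -/
theorem hClose.subset_of_ne_singleton {κ : Type*} {B A : Set κ} {x : κ}
    (h : hClose B A {x}) (hA : A.Nonempty) (hne : A ≠ {x}) : A ⊆ B := by
  by_cases hx : x ∈ B
  · rintro y hy
    rcases h.1 hy with rfl | hy
    exacts [hx, hy.1]
  · have hsub := h.1
    rw [dE_eq_self (by simpa using hx)] at hsub
    exact absurd (hA.subset_singleton_iff.1 hsub) hne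

/-- A nonempty set close to a singleton and to a nonempty non-singleton lies inside `B`. -/
theorem subset_of_hClose_singleton_of_hClose {κ : Type*} {B A C : Set κ} {x : κ}
    (hA : A.Nonempty) (hC : C.Nonempty) (hC1 : C.ncard ≠ 1)
    (hAx : hClose B A {x}) (hAC : hClose B A C) : A ⊆ B := by
  by_cases h : A = {x}
  · subst h
    by_cases hx : x ∈ B
    · simpa using hx
    · have hsub := hAC.2
      rw [dE_eq_self (by simpa using hx), hC.subset_singleton_iff] at hsub
      exact absurd (hsub ▸ Set.ncard_singleton x) hC1
  · exact hAx.subset_of_ne_singleton hA h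

theorem hClose_of_subset {κ : Type*} {B A : Set κ} (hA : A.Nonempty) (h : A ⊆ B) :
    hClose B A B :=
  ⟨fun _ hy => Or.inl (h hy),
    fun _ hy => Or.inr ⟨hy, by rwa [Set.inter_eq_left.2 h]⟩⟩

/-- In `[κ]^𝓑`, the set of singletons and its complement are asymptotically
disjoint. -/
theorem hyperballean_singletons_asympDisjoint_complement {κ : Type*} [Infinite κ]
    (𝓑 : Set (Set κ)) (hB : IsBornology 𝓑) (hunb : Set.univ ∉ 𝓑) :
    hAsympDisjoint 𝓑 {A ∈ hyper 𝓑 | A.ncard = 1} (hyper 𝓑 \ {A ∈ hyper 𝓑 | A.ncard = 1}) := by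
  rintro B hBB
  obtain ⟨p⟩ : Nonempty κ := inferInstance
  have hp : B ∪ {p} ∈ 𝓑 := hB.2.2 _ _ hBB (hB.1 _ (Set.finite_singleton p))
  refine ⟨B ∪ {p}, hp, B ∪ {p}, ⟨hp, p, Or.inr rfl⟩, ?_⟩
  rintro A ⟨⟨⟨-, hA⟩, S, ⟨-, hS⟩, hAS⟩, -, C, ⟨hC, hC1⟩, hAC⟩
  obtain ⟨x, rfl⟩ := Set.ncard_eq_one.1 hS
  have hAB : A ⊆ B := subset_of_hClose_singleton_of_hClose hA hC.2
    (fun h => hC1 ⟨hC, h⟩) hAS hAC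
  exact hClose_of_subset hA (hAB.trans Set.subset_union_left)
end
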